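/- Let S be a nonempty finite set of points in a finite-dimensional real vector space E. Then there exist a geometric simplicial complex K in E with finitely many faces and a point v ∈ S such that every vertex of K lies in S, the underlying space |K| equals the convex hull of S, and v belongs to every face of K that is maximal with respect to inclusion. -/

import Mathlib

open Finset Topology

/-- `LexPos S d` says that `d` is lexicographically positive on `S`: its first nonzero value on
`S`, in the order of `E`, is positive. -/
def LexPos {E : Type*} [LinearOrder E] (S : Finset E) (d : E → ℝ) : Prop :=
  ∃ i ∈ S, 0 < d i ∧ ∀ j ∈ S, j < i → d j = 0

/-- `IsLexMax S w` says that `w` is lexicographically maximal among the nonnegative weights on `S`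
with the same total mass and the same moment. -/
def IsLexMax {E : Type*} [AddCommGroup E] [Module ℝ E] [LinearOrder E]
    (S : Finset E) (w : E → ℝ) : Prop :=
  ∀ u : E → ℝ, (∀ y ∈ S, 0 ≤ u y) → ∑ y ∈ S, u y = ∑ y ∈ S, w y →
    ∑ y ∈ S, u y • y = ∑ y ∈ S, w y • y → ¬ LexPos S (u - w)

/-- The faces of the pulling triangulation of `S`, together with the empty set: the subsets of `S`
on which every nonnegative weight is lexicographically maximal. -/
def pullingFaces {E : Type*} [AddCommGroup E] [Module ℝ E] [LinearOrder E]
    (S : Finset E) : Set (Finset E) :=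
  {F | F ⊆ S ∧ ∀ w : E → ℝ, (∀ y, 0 ≤ w y) → (∀ y, y ∉ F → w y = 0) → IsLexMax S w}

section LexPos

variable {E : Type*} [LinearOrder E] {S : Finset E} {d e : E → ℝ}

theorem LexPos.congr (hd : LexPos S d) (h : ∀ y ∈ S, e y = d y) : LexPos S e := by
  obtain ⟨i, hi, hpos, hlt⟩ := hd
  exact ⟨i, hi, by rwa [h i hi], fun j hj hji => by rw [h j hj, hlt j hj hji]⟩

theorem LexPos.smul (hd : LexPos S d) {c : ℝ} (hc : 0 < c) : LexPos S (c • d) := by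
  obtain ⟨i, hi, hpos, hlt⟩ := hd
  exact ⟨i, hi, by simpa using mul_pos hc hpos, fun j hj hji => by simp [hlt j hj hji]⟩

theorem lexPos_or_lexPos_neg {y : E} (hy : y ∈ S) (hdy : d y ≠ 0) :
    LexPos S d ∨ LexPos S (-d) := by
  have hne : (S.filter (d · ≠ 0)).Nonempty := ⟨y, by simp [hy, hdy]⟩
  obtain ⟨hiS, hi⟩ := mem_filter.1 (min'_mem _ hne)
  have hlt : ∀ j ∈ S, j < (S.filter (d · ≠ 0)).min' hne → d j = 0 := by
    intro j hj hji
    by_contra h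
    exact (min'_le _ j (mem_filter.2 ⟨hj, h⟩)).not_gt hji
  rcases hi.lt_or_gt with h | h
  · exact .inr ⟨_, hiS, by simpa using h, fun j hj hji => by simp [hlt j hj hji]⟩
  · exact .inl ⟨_, hiS, h, hlt⟩

theorem LexPos.nonneg_of_forall_le (hd : LexPos S d) {v : E} (hv : v ∈ S)
    (hmin : ∀ y ∈ S, v ≤ y) : 0 ≤ d v := by
  obtain ⟨i, hi, hpos, hlt⟩ := hd
  rcases (hmin i hi).eq_or_lt with rfl | h
  · exact hpos.le
  · exact (hlt v hv h).ge

/-- A nonempty compact set of functions has a lexicographically maximal element. -/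
theorem IsCompact.exists_forall_not_lexPos_sub (S : Finset E) {K : Set (E → ℝ)}
    (hK : IsCompact K) (hne : K.Nonempty) : ∃ w ∈ K, ∀ u ∈ K, ¬ LexPos S (u - w) := by
  induction S using Finset.induction_on_min generalizing K with
  | empty =>
    obtain ⟨w, hw⟩ := hne
    exact ⟨w, hw, fun u _ ⟨i, hi, _⟩ => by simp at hi⟩
  | insert a T ha ih =>
    obtain ⟨m, hm, hmax⟩ := hK.exists_isMaxOn hne (continuous_apply a).continuousOn
    have hclosed : IsClosed {w : E → ℝ | w a = m a} :=
      isClosed_eq (continuous_apply a) continuous_const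
    obtain ⟨w, ⟨hwK, hwa⟩, hw⟩ := ih (hK.inter_right hclosed) ⟨m, hm, rfl⟩
    refine ⟨w, hwK, fun u hu ⟨i, hi, hpos, hlt⟩ => ?_⟩
    rcases mem_insert.1 hi with rfl | hiT
    · have h1 : u i ≤ m i := hmax hu
      have h2 : w i = m i := hwa
      simp only [Pi.sub_apply] at hpos
      linarith
    · have hua : u a = w a := by
        simpa [sub_eq_zero] using hlt a (mem_insert_self _ _) (ha i hiT)
      exact hw u ⟨hu, hua.trans hwa⟩
        ⟨i, hiT, hpos, fun j hj hji => hlt j (mem_insert_of_mem hj) hji⟩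

end LexPos

section Weights

variable {E : Type*} [AddCommGroup E] [Module ℝ E] {S F : Finset E}

theorem isClosed_setOf_sum_smul_eq [FiniteDimensional ℝ E] (S : Finset E) (x : E) :
    IsClosed {w : E → ℝ | ∑ y ∈ S, w y • y = x} := by
  let b := Module.finBasis ℝ E
  have : {w : E → ℝ | ∑ y ∈ S, w y • y = x} =
      ⋂ i, {w : E → ℝ | ∑ y ∈ S, w y * b.repr y i = b.repr x i} := by
    ext w
    simp only [Set.mem_ofPred_eq, Set.mem_iInter]
    rw [← b.repr.injective.eq_iff, DFunLike.ext_iff]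
    simp
  rw [this]
  exact isClosed_iInter fun i => isClosed_eq (by fun_prop) continuous_const

theorem mem_convexHull_of_weight (hFS : F ⊆ S) {x : E} {w : E → ℝ} (hw : ∀ y, 0 ≤ w y)
    (hwF : ∀ y ∈ S, y ∉ F → w y = 0) (h1 : ∑ y ∈ S, w y = 1) (h2 : ∑ y ∈ S, w y • y = x) :
    x ∈ convexHull ℝ (F : Set E) := by
  refine Finset.mem_convexHull'.2 ⟨w, fun y _ => hw y, ?_, ?_⟩
  · rwa [sum_subset hFS hwF]
  · rwa [sum_subset hFS fun y hy hyF => by simp [hwF y hy hyF]]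

end Weights

section Pulling

variable {E : Type*} [AddCommGroup E] [Module ℝ E] [LinearOrder E] {S F G : Finset E}

/-- Every nonnegative weight of total mass one can be replaced by a lexicographically maximal one
with the same moment. -/
theorem exists_isLexMax [FiniteDimensional ℝ E] {x : E}
    (hx : x ∈ convexHull ℝ (S : Set E)) :
    ∃ w : E → ℝ, (∀ y, 0 ≤ w y) ∧ (∀ y, y ∉ S → w y = 0) ∧ ∑ y ∈ S, w y = 1 ∧
      ∑ y ∈ S, w y • y = x ∧ IsLexMax S w := by
  let K : Set (E → ℝ) :=
    (Set.univ.pi fun y => Set.Icc 0 (if y ∈ S then 1 else 0)) ∩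
      ({w | ∑ y ∈ S, w y = 1} ∩ {w | ∑ y ∈ S, w y • y = x})
  have hK : IsCompact K := (isCompact_univ_pi fun _ => isCompact_Icc).inter_right
    ((isClosed_eq (by fun_prop) continuous_const).inter (isClosed_setOf_sum_smul_eq S x))
  have key : ∀ u : E → ℝ, (∀ y ∈ S, 0 ≤ u y) → ∑ y ∈ S, u y = 1 → ∑ y ∈ S, u y • y = x →
      (fun y => if y ∈ S then u y else 0) ∈ K := by
    intro u h0 h1 h2
    refine ⟨fun y _ => ?_, ?_, ?_⟩
    · by_cases hy : y ∈ S
      · simpa [hy, h0 y hy] using h1 ▸ single_le_sum h0 hy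
      · simp [hy]
    · simpa [sum_ite_mem] using h1
    · simpa [ite_smul, sum_ite_mem] using h2
  obtain ⟨u, h0, h1, h2⟩ := Finset.mem_convexHull'.1 hx
  obtain ⟨w, ⟨hw, hw1, hw2⟩, hmax⟩ := hK.exists_forall_not_lexPos_sub S ⟨_, key u h0 h1 h2⟩
  refine ⟨w, fun y => (hw y trivial).1, fun y hy => ?_, hw1, hw2, fun u h0 h1 h2 h => ?_⟩
  · have := hw y trivial
    simp only [hy, if_false] at this
    exact le_antisymm this.2 this.1
  · exact hmax _ (key u h0 (h1.trans hw1) (h2.trans hw2)) (h.congr fun y hy => by simp [hy])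

theorem IsLexMax.support_mem_pullingFaces {w : E → ℝ} (hw : IsLexMax S w)
    (hw0 : ∀ y, 0 ≤ w y) : S.filter (w · ≠ 0) ∈ pullingFaces S := by
  refine ⟨filter_subset _ _, fun u hu0 hu u' hu'0 h1 h2 hpos => ?_⟩
  have hε : ∀ᶠ ε : ℝ in 𝓝[>] 0, ∀ y ∈ S, ε * u y ≤ w y := by
    rw [Filter.eventually_all_finset]
    intro y hy
    by_cases hwy : w y = 0
    · exact .of_forall fun ε => by simp [hu y (by simp [hwy]), hwy]
    · have hlim : Filter.Tendsto (fun ε : ℝ => ε * u y) (𝓝[>] 0) (𝓝 0) :=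
        ((continuous_id.mul continuous_const).tendsto' 0 0 (by simp)).mono_left
          nhdsWithin_le_nhds
      exact (hlim.eventually_lt_const ((hw0 y).lt_of_ne' hwy)).mono fun _ h => h.le
  obtain ⟨ε, hε, hε0⟩ := (hε.and self_mem_nhdsWithin).exists
  have hε0 : 0 < ε := hε0
  refine hw (w + ε • (u' - u)) (fun y hy => ?_) ?_ ?_ (by simpa using hpos.smul hε0)
  · have := mul_nonneg hε0.le (hu'0 y hy)
    have := hε y hy
    simp only [Pi.add_apply, Pi.smul_apply, Pi.sub_apply, smul_eq_mul]
    linarith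
  · simp [sum_add_distrib, ← mul_sum, h1]
  · simp [add_smul, sum_add_distrib, mul_smul, ← smul_sum, sub_smul, h2]

theorem eq_of_mem_pullingFaces (hF : F ∈ pullingFaces S) (hG : G ∈ pullingFaces S)
    {w u : E → ℝ} (hw : ∀ y, 0 ≤ w y) (hwF : ∀ y, y ∉ F → w y = 0)
    (hu : ∀ y, 0 ≤ u y) (huG : ∀ y, y ∉ G → u y = 0)
    (h1 : ∑ y ∈ S, w y = ∑ y ∈ S, u y) (h2 : ∑ y ∈ S, w y • y = ∑ y ∈ S, u y • y) : w = u := by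
  ext y
  by_cases hy : y ∈ S
  · by_contra hne
    rcases lexPos_or_lexPos_neg (d := w - u) hy (by simpa [sub_eq_zero] using hne) with h | h
    · exact hG.2 u hu huG w (fun y _ => hw y) h1 h2 h
    · exact hF.2 w hw hwF u (fun y _ => hu y) h1.symm h2.symm (by simpa using h)
  · rw [hwF y fun h => hy (hF.1 h), huG y fun h => hy (hG.1 h)]

theorem isLowerSet_pullingFaces : IsLowerSet (pullingFaces S) := fun _ _ hGF hF =>
  ⟨hGF.trans hF.1, fun w hw hwG => hF.2 w hw fun y hy => hwG y fun h => hy (hGF h)⟩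

theorem affineIndependent_of_mem_pullingFaces (hF : F ∈ pullingFaces S) :
    AffineIndependent ℝ ((↑) : F → E) := by
  rw [affineIndependent_iff]
  intro s d h1 h2 i hi
  let c : E → ℝ := fun y => if h : y ∈ F then if ⟨y, h⟩ ∈ s then d ⟨y, h⟩ else 0 else 0
  have hcF : ∀ y, y ∉ F → c y = 0 := fun y hy => by simp [c, hy]
  have hc : ∀ y : F, c y = if y ∈ s then d y else 0 := fun y => by simp [c]
  have hc1 : ∑ y ∈ S, c y = 0 := by
    rw [← sum_subset hF.1 fun y _ hy => hcF y hy, ← sum_coe_sort]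
    simpa [-univ_eq_attach, hc, sum_ite_mem] using h1
  have hc2 : ∑ y ∈ S, c y • y = 0 := by
    rw [← sum_subset hF.1 fun y _ hy => by simp [hcF y hy], ← sum_coe_sort]
    simpa [-univ_eq_attach, hc, ite_smul, sum_ite_mem] using h2
  have hsplit : ∀ y, c y = max (c y) 0 - max (-c y) 0 := fun y => by
    rcases le_total (c y) 0 with h | h <;> simp [h]
  have heq : (fun y => max (c y) 0) = fun y => max (-c y) 0 := by
    refine eq_of_mem_pullingFaces hF hF (fun y => le_max_right _ _)
      (fun y hy => by simp [hcF y hy]) (fun y => le_max_right _ _)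
      (fun y hy => by simp [hcF y hy]) ?_ ?_
    · rwa [← sub_eq_zero, ← sum_sub_distrib, sum_congr rfl fun y _ => (hsplit y).symm]
    · rwa [← sub_eq_zero, ← sum_sub_distrib,
        sum_congr rfl fun y _ => by rw [← sub_smul, ← hsplit y]]
  have hci : c i = 0 := by
    rw [hsplit i, sub_eq_zero]
    exact congrFun heq i
  simpa [hc, hi] using hci

theorem exists_weight_of_mem_convexHull (hFS : F ⊆ S) {x : E}
    (hx : x ∈ convexHull ℝ (F : Set E)) :
    ∃ w : E → ℝ, (∀ y, 0 ≤ w y) ∧ (∀ y, y ∉ F → w y = 0) ∧ ∑ y ∈ S, w y = 1 ∧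
      ∑ y ∈ S, w y • y = x := by
  obtain ⟨u, h0, h1, h2⟩ := Finset.mem_convexHull'.1 hx
  refine ⟨fun y => if y ∈ F then u y else 0, fun y => ?_, fun y hy => by simp [hy], ?_, ?_⟩
  · dsimp only
    split_ifs with hy
    exacts [h0 y hy, le_rfl]
  · simpa [sum_ite_mem, inter_eq_right.2 hFS] using h1
  · simpa [ite_smul, sum_ite_mem, inter_eq_right.2 hFS] using h2

theorem convexHull_inter_subset_of_mem_pullingFaces (hF : F ∈ pullingFaces S)
    (hG : G ∈ pullingFaces S) :
    convexHull ℝ (F : Set E) ∩ convexHull ℝ (G : Set E) ⊆ convexHull ℝ (F ∩ G : Set E) := by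
  rintro x ⟨hxF, hxG⟩
  obtain ⟨w, hw, hwF, hw1, hw2⟩ := exists_weight_of_mem_convexHull hF.1 hxF
  obtain ⟨u, hu, huG, hu1, hu2⟩ := exists_weight_of_mem_convexHull hG.1 hxG
  obtain rfl := eq_of_mem_pullingFaces hF hG hw hwF hu huG (hw1.trans hu1.symm)
    (hw2.trans hu2.symm)
  rw [← coe_inter]
  refine mem_convexHull_of_weight (inter_subset_left.trans hF.1) hw (fun y _ hy => ?_) hw1 hw2
  by_cases hyF : y ∈ F
  · exact huG y fun hyG => hy (mem_inter.2 ⟨hyF, hyG⟩)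
  · exact hwF y hyF

/-- The pulling triangulation is a cone with apex the least point of `S`. -/
theorem insert_mem_pullingFaces (hF : F ∈ pullingFaces S) {v : E} (hv : v ∈ S)
    (hmin : ∀ y ∈ S, v ≤ y) : insert v F ∈ pullingFaces S := by
  refine ⟨insert_subset hv hF.1, fun w hw hwF u hu h1 h2 hpos => ?_⟩
  have hle : w v ≤ u v := by simpa using hpos.nonneg_of_forall_le hv hmin
  let e : E → ℝ := Pi.single v (w v)
  refine hF.2 (w - e) (fun y => ?_) (fun y hy => ?_) (u - e) (fun y hy => ?_) ?_ ?_
    (by simpa using hpos)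
  · by_cases hyv : y = v
    · subst hyv; simp [e]
    · simpa [e, hyv] using hw y
  · by_cases hyv : y = v
    · subst hyv; simp [e]
    · simpa [e, hyv] using hwF y (by simp [hyv, hy])
  · by_cases hyv : y = v
    · subst hyv; simpa [e] using hle
    · simpa [e, hyv] using hu y hy
  · simp [h1]
  · simp [sub_smul, h2]

/-- The pulling triangulation of a finite set of points in a linearly ordered vector space. The
order needs no compatibility with the vector space structure. -/
def pullingTriangulation (S : Finset E) : Geometry.SimplicialComplex ℝ E :=
  .ofErase (pullingFaces S) (fun _ => affineIndependent_of_mem_pullingFaces)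
    isLowerSet_pullingFaces fun _ hF _ hG => convexHull_inter_subset_of_mem_pullingFaces hF hG

theorem mem_faces_pullingTriangulation :
    F ∈ (pullingTriangulation S).faces ↔ F ∈ pullingFaces S ∧ F ≠ ∅ := Iff.rfl

theorem space_pullingTriangulation [FiniteDimensional ℝ E] (S : Finset E) :
    (pullingTriangulation S).space = convexHull ℝ (S : Set E) := by
  ext x
  rw [Geometry.SimplicialComplex.mem_space_iff]
  constructor
  · rintro ⟨F, hF, hx⟩
    exact convexHull_mono (coe_subset.2 hF.1.1) hx
  · intro hx
    obtain ⟨w, hw, -, h1, h2, hmax⟩ := exists_isLexMax hx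
    have hxF : x ∈ convexHull ℝ (S.filter (w · ≠ 0) : Set E) :=
      mem_convexHull_of_weight (filter_subset _ _) hw
        (fun y hy h => by simpa [hy] using h) h1 h2
    refine ⟨_, ⟨hmax.support_mem_pullingFaces hw, fun h => ?_⟩, hxF⟩
    rw [Set.mem_singleton_iff.1 h] at hxF
    simp at hxF

end Pulling

/-- Let `S` be a nonempty finite set of points in a finite-dimensional
real vector space `E`. Then there exist a geometric simplicial complex `K` in `E` with
finitely many faces and a point `v ∈ S` such that every vertex of `K` lies in `S`, the
underlying space of `K` equals the convex hull of `S`, and `v` belongs to every face of `K`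
that is maximal with respect to inclusion (a pointed triangulation of the polytope
`conv S`). -/
theorem exists_pointed_triangulation {E : Type*} [AddCommGroup E] [Module ℝ E]
    [FiniteDimensional ℝ E] (S : Finset E) (hS : S.Nonempty) :
    ∃ (K : Geometry.SimplicialComplex ℝ E) (v : E),
      v ∈ S ∧
      K.faces.Finite ∧
      K.vertices ⊆ ↑S ∧
      K.space = convexHull ℝ (S : Set E) ∧
      ∀ F ∈ K.faces, (∀ G ∈ K.faces, F ⊆ G → F = G) → v ∈ F := by
  classical
  let _ : LinearOrder E := linearOrderOfSTO WellOrderingRel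
  have hv := S.min'_mem hS
  refine ⟨pullingTriangulation S, S.min' hS, hv, ?_, fun x hx => ?_,
    space_pullingTriangulation S, fun F hF hmax => ?_⟩
  · exact S.powerset.finite_toSet.subset fun F hF => mem_coe.2 (mem_powerset.2 hF.1.1)
  · exact hx.1.1 (mem_singleton_self x)
  · rw [hmax (insert (S.min' hS) F) ?_ (subset_insert _ _)]
    · exact mem_insert_self _ _
    · exact mem_faces_pullingTriangulation.2
        ⟨insert_mem_pullingFaces hF.1 hv fun y hy => S.min'_le y hy, insert_ne_empty _ _⟩
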